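/- arXiv:2508.20174 — 3 statements merged into one kernel-verified Lean document; each statement's English description precedes it below -/
import Mathlib

section
/- CIPEC negativity upper bound (Lemma 3 of the paper): let G be a positive natural number, c_* ≥ 0 a constant such that N(x) ≤ c_* · ‖x‖ for all x ∈ E, and let u, w : Fin G → E, ε_c : Fin G → ℝ, L : Fin G → ℕ, and ε_Q ≥ 0 satisfy ‖u i − w i‖ ≤ ε_c i + (L i) · ε_Q for every i. Then the total negativity γ := Π_{i} (1 + N(u i − w i)) satisfies γ ≤ exp( Σ_i c_* · (ε_c i + (L i) · ε_Q) ). (Here u i is the ideal two-qubit unitary channel U_i, w i is its noisy compiled length-L_i sequence with compilation error ε_{c,i} and per-gate noise ε_Q, and 1 + N(u i − w i) is the minimal negativity γ_i of the compilation-informed quasi-probability decomposition of U_i.) -/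
/-- The negativity of `x` with respect to the family `v`: the infimum of the ℓ¹-norms of
coefficient vectors representing `x` as a linear combination of the `v j`. -/
noncomputable def negativity {E : Type*} [NormedAddCommGroup E] [NormedSpace ℝ E]
    {n : ℕ} (v : Fin n → E) (x : E) : ℝ :=
  sInf {s : ℝ | ∃ b : Fin n → ℝ, (∑ j, b j • v j) = x ∧ s = ∑ j, |b j|}

theorem negativity_nonneg {E : Type*} [NormedAddCommGroup E] [NormedSpace ℝ E]
    {n : ℕ} (v : Fin n → E) (x : E) : 0 ≤ negativity v x := by
  refine Real.sInf_nonneg ?_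
  rintro s ⟨b, -, rfl⟩
  exact Finset.sum_nonneg fun j _ => abs_nonneg (b j)

/-- **CIPEC negativity upper bound** (Lemma 3): if `N(x) ≤ c_* ‖x‖` for all `x`, and each
ideal gate `u i` is approximated by its noisy compiled sequence `w i` to error
`ε_{c,i} + L_i ε_Q`, then the total negativity `γ = Π_i (1 + N(u i − w i))` satisfies
`γ ≤ exp(Σ_i c_* (ε_{c,i} + L_i ε_Q))`. -/
theorem cipec_negativity_upper_bound {E : Type*} [NormedAddCommGroup E] [NormedSpace ℝ E]
    [FiniteDimensional ℝ E] [Nontrivial E]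
    (n : ℕ) (hn : 0 < n) (v : Fin n → E)
    (hv : Submodule.span ℝ (Set.range v) = ⊤)
    (G : ℕ) (hG : 0 < G) (cstar : ℝ) (hcstar : 0 ≤ cstar)
    (hbound : ∀ x : E, negativity v x ≤ cstar * ‖x‖)
    (u w : Fin G → E) (εc : Fin G → ℝ) (L : Fin G → ℕ) (εQ : ℝ) (hεQ : 0 ≤ εQ)
    (happrox : ∀ i, ‖u i - w i‖ ≤ εc i + (L i : ℝ) * εQ) :
    (∏ i, (1 + negativity v (u i - w i)))
      ≤ Real.exp (∑ i, cstar * (εc i + (L i : ℝ) * εQ)) := by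
  rw [Real.exp_sum]
  refine Finset.prod_le_prod (fun i _ => add_nonneg zero_le_one (negativity_nonneg v _))
    fun i _ => ?_
  calc 1 + negativity v (u i - w i)
      ≤ cstar * (εc i + (L i : ℝ) * εQ) + 1 := by
        rw [add_comm]
        gcongr
        exact (hbound _).trans (mul_le_mul_of_nonneg_left (happrox i) hcstar)
    _ ≤ Real.exp (cstar * (εc i + (L i : ℝ) * εQ)) := Real.add_one_le_exp _
end

section
/- Negativity part of Theorem 1 (CIPEC): let G be a positive natural number, c_* > 0, ε_Q > 0, and γ₁, γ₂ > 1 real constants. Let γ : Fin G → ℝ, ε_c : Fin G → ℝ, and L : Fin G → ℕ satisfy, for every i: 1 ≤ γ i, γ i ≤ 1 + c_* · (ε_c i + (L i) · ε_Q), 0 ≤ ε_c i ≤ log(γ₁) / (2 · c_* · G), and suppose the total length satisfies Σ_i L i ≤ log(γ₂) / (2 · c_* · ε_Q). Then the total negativity Π_i γ i is at most √(γ₁ · γ₂); equivalently, the sample overhead (Π_i γ i)² is at most γ₁ · γ₂, a constant independent of the target precision. -/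
/-- A finite product of nonnegative reals, each at most `1 + x i`, is at most `exp (∑ i, x i)`. -/
theorem Finset.prod_le_exp_sum_of_le_one_add {ι : Type*} (s : Finset ι) {f x : ι → ℝ}
    (hf : ∀ i ∈ s, 0 ≤ f i) (hfx : ∀ i ∈ s, f i ≤ 1 + x i) :
    ∏ i ∈ s, f i ≤ Real.exp (∑ i ∈ s, x i) := by
  rw [Real.exp_sum]
  refine Finset.prod_le_prod hf fun i hi => (hfx i hi).trans ?_
  rw [add_comm]
  exact Real.add_one_le_exp (x i)

/-- **Negativity part of Theorem 1 (CIPEC)**: if each gate is compiled to error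
`ε_{c,i} ≤ log γ₁ / (2 c_* G)` and the total compiled length satisfies
`Σ_i L_i ≤ log γ₂ / (2 c_* ε_Q)`, then the total negativity `Π_i γ_i` is at most
`√(γ₁ γ₂)`; equivalently, the sample overhead `(Π_i γ_i)²` is at most `γ₁ γ₂`,
a constant independent of the target precision. -/
theorem cipec_constant_overhead
    (G : ℕ) (hG : 0 < G) (cstar εQ γ₁ γ₂ : ℝ)
    (hcstar : 0 < cstar) (hεQ : 0 < εQ) (hγ₁ : 1 < γ₁) (hγ₂ : 1 < γ₂)
    (γ εc : Fin G → ℝ) (L : Fin G → ℕ)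
    (hγ_lb : ∀ i, 1 ≤ γ i)
    (hγ_ub : ∀ i, γ i ≤ 1 + cstar * (εc i + (L i : ℝ) * εQ))
    (hεc_lb : ∀ i, 0 ≤ εc i)
    (hεc_ub : ∀ i, εc i ≤ Real.log γ₁ / (2 * cstar * G))
    (hL : (∑ i, (L i : ℝ)) ≤ Real.log γ₂ / (2 * cstar * εQ)) :
    (∏ i, γ i) ≤ Real.sqrt (γ₁ * γ₂) ∧ (∏ i, γ i) ^ 2 ≤ γ₁ * γ₂ := by
  have h_eps : cstar * ∑ i, εc i ≤ Real.log γ₁ / 2 := by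
    have hG' : (0 : ℝ) < G := Nat.cast_pos.mpr hG
    calc cstar * ∑ i, εc i
        ≤ cstar * ∑ _i : Fin G, Real.log γ₁ / (2 * cstar * G) := by
          gcongr with i
          exact hεc_ub i
      _ = Real.log γ₁ / 2 := by
          rw [Finset.sum_const, Finset.card_univ, Fintype.card_fin, nsmul_eq_mul]
          field_simp
  have h_len : cstar * ((∑ i, (L i : ℝ)) * εQ) ≤ Real.log γ₂ / 2 := by
    calc cstar * ((∑ i, (L i : ℝ)) * εQ)
        ≤ cstar * (Real.log γ₂ / (2 * cstar * εQ) * εQ) := by gcongr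
      _ = Real.log γ₂ / 2 := by field_simp
  have h_sum : 2 * ∑ i, cstar * (εc i + (L i : ℝ) * εQ) ≤ Real.log (γ₁ * γ₂) := by
    rw [← Finset.mul_sum, Finset.sum_add_distrib, ← Finset.sum_mul,
      Real.log_mul (by positivity) (by positivity)]
    linarith
  have h_nonneg : ∀ i ∈ Finset.univ, 0 ≤ γ i := fun i _ => zero_le_one.trans (hγ_lb i)
  have h_sq : (∏ i, γ i) ^ 2 ≤ γ₁ * γ₂ := by
    calc (∏ i, γ i) ^ 2
        ≤ Real.exp (∑ i, cstar * (εc i + (L i : ℝ) * εQ)) ^ 2 :=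
          pow_le_pow_left₀ (Finset.prod_nonneg h_nonneg)
            (Finset.prod_le_exp_sum_of_le_one_add _ h_nonneg fun i _ => hγ_ub i) 2
      _ = Real.exp (2 * ∑ i, cstar * (εc i + (L i : ℝ) * εQ)) := by
          rw [← Real.exp_nat_mul, Nat.cast_ofNat]
      _ ≤ γ₁ * γ₂ := (Real.le_log_iff_exp_le (by positivity)).mp h_sum
  exact ⟨Real.le_sqrt_of_sq_le h_sq, h_sq⟩
end

section
/- General overhead bound beyond the feasibility regime: let G be a positive natural number, c_* > 0, ε_Q ≥ 0, γ₁ > 1, and let γ : Fin G → ℝ, ε_c : Fin G → ℝ, L : Fin G → ℕ satisfy, for every i: 1 ≤ γ i, γ i ≤ 1 + c_* · (ε_c i + (L i) · ε_Q), and 0 ≤ ε_c i ≤ log(γ₁) / (2 · c_* · G). Then, writing Ltot := Σ_i L i, the total negativity satisfies Π_i γ i ≤ exp( (1/2) · log(γ₁) + c_* · Ltot · ε_Q ). (This shows that even when the circuit length exceeds L_max, CIPEC solves the estimation problem with sample overhead growing at most exponentially in c_* · L · ε_Q.) -/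
/-- **General overhead bound beyond the feasibility regime**: with compilation errors
`ε_{c,i} ≤ log γ₁ / (2 c_* G)`, the total negativity satisfies
`Π_i γ_i ≤ exp((1/2) log γ₁ + c_* Ltot ε_Q)` where `Ltot = Σ_i L_i`; thus even when the
circuit length exceeds `L_max`, CIPEC solves the estimation problem with sample overhead
growing at most exponentially in `c_* L ε_Q`. -/
theorem cipec_general_overhead_bound
    (G : ℕ) (hG : 0 < G) (cstar εQ γ₁ : ℝ)
    (hcstar : 0 < cstar) (hεQ : 0 ≤ εQ) (hγ₁ : 1 < γ₁)
    (γ εc : Fin G → ℝ) (L : Fin G → ℕ)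
    (hγ_lb : ∀ i, 1 ≤ γ i)
    (hγ_ub : ∀ i, γ i ≤ 1 + cstar * (εc i + (L i : ℝ) * εQ))
    (hεc_lb : ∀ i, 0 ≤ εc i)
    (hεc_ub : ∀ i, εc i ≤ Real.log γ₁ / (2 * cstar * G)) :
    (∏ i, γ i) ≤ Real.exp ((1 / 2) * Real.log γ₁ + cstar * (∑ i, (L i : ℝ)) * εQ) := by
  have hG' : (0 : ℝ) < G := Nat.cast_pos.mpr hG
  have factor_le : ∀ i, γ i ≤ Real.exp (cstar * (εc i + (L i : ℝ) * εQ)) := fun i =>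
    (hγ_ub i).trans (by simpa only [add_comm] using Real.add_one_le_exp _)
  have sum_εc_le : ∑ i, εc i ≤ G * (Real.log γ₁ / (2 * cstar * G)) := by
    simpa using Finset.sum_le_sum fun i (_ : i ∈ Finset.univ) => hεc_ub i
  calc ∏ i, γ i ≤ ∏ i, Real.exp (cstar * (εc i + (L i : ℝ) * εQ)) :=
        Finset.prod_le_prod (fun i _ => zero_le_one.trans (hγ_lb i)) fun i _ => factor_le i
    _ = Real.exp (cstar * ∑ i, εc i + cstar * (∑ i, (L i : ℝ)) * εQ) := by
        rw [← Real.exp_sum, ← Finset.mul_sum, Finset.sum_add_distrib, ← Finset.sum_mul,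
          mul_add, mul_assoc]
    _ ≤ Real.exp (cstar * (G * (Real.log γ₁ / (2 * cstar * G)))
          + cstar * (∑ i, (L i : ℝ)) * εQ) := by gcongr
    _ = Real.exp ((1 / 2) * Real.log γ₁ + cstar * (∑ i, (L i : ℝ)) * εQ) := by
        congr 2
        field_simp
end
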